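/- arXiv:math/0501364 — 2 statements merged into one kernel-verified Lean document; each statement's English description precedes it below -/
import Mathlib

section
/- Let M be a noetherian, atomistic, biatomic, join-semidistributive lattice with zero. Then M satisfies the quasi-identity: if u ≤ a ∨ b ∨ v, v ≤ a ∨ c ∨ u, (a ∨ u) ∧ (b ∨ c) ≤ a, and (a ∨ b) ∧ (a ∨ u) = (a ∨ c) ∧ (a ∨ v) = (a ∨ u) ∧ (a ∨ v) = a, then u ≤ a. -/
def NoetherianOrd (L : Type*) [Preorder L] : Prop :=
  ∀ s : Set L, s.Nonempty → ∃ m ∈ s, ∀ x ∈ s, ¬ m < x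

def IsBiatomicLat (L : Type*) [Lattice L] [OrderBot L] : Prop :=
  (∀ x : L, x ≠ ⊥ → ∃ p : L, IsAtom p ∧ p ≤ x) ∧
  ∀ p a b : L, IsAtom p → a ≠ ⊥ → b ≠ ⊥ → p ≤ a ⊔ b →
    ∃ x y : L, IsAtom x ∧ x ≤ a ∧ IsAtom y ∧ y ≤ b ∧ p ≤ x ⊔ y

def AtomisticLat (L : Type*) [Lattice L] [OrderBot L] : Prop :=
  ∀ x : L, ∃ s : Set L, (∀ p ∈ s, IsAtom p) ∧ IsLUB s x

def JoinSemidistributive (L : Type*) [Lattice L] : Prop :=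
  ∀ x y z : L, x ⊔ y = x ⊔ z → x ⊔ y = x ⊔ (y ⊓ z)

theorem stmt_13 (M : Type) [Lattice M] [OrderBot M]
    (hN : NoetherianOrd M) (hA : AtomisticLat M) (hB : IsBiatomicLat M)
    (hSD : JoinSemidistributive M)
    (a b c u v : M)
    (h1 : u ≤ a ⊔ b ⊔ v) (h2 : v ≤ a ⊔ c ⊔ u)
    (h3 : (a ⊔ u) ⊓ (b ⊔ c) ≤ a)
    (h4 : (a ⊔ b) ⊓ (a ⊔ u) = a)
    (h5 : (a ⊔ c) ⊓ (a ⊔ v) = a)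
    (h6 : (a ⊔ u) ⊓ (a ⊔ v) = a) :
    u ≤ a := by
  by_contra hu
  have hb : ∀ x y p : M, IsAtom p → p ≤ x ⊔ y → ¬ p ≤ x → ¬ p ≤ y →
      ∃ x' y' : M, IsAtom x' ∧ x' ≤ x ∧ IsAtom y' ∧ y' ≤ y ∧ p ≤ x' ⊔ y' := by
    intro x y p hp hxy hx hy
    refine hB.2 p x y hp ?_ ?_ hxy
    · rintro rfl
      exact hy (by simpa using hxy)
    · rintro rfl
      exact hx (by simpa using hxy)
  have hP : ∀ p : M, IsAtom p → p ≤ a ⊔ u → ¬ p ≤ a →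
      ∃ q : M, IsAtom q ∧ q ≤ a ⊔ v ∧ ¬ q ≤ a ∧ p ≤ b ⊔ c ⊔ q := by
    intro p hp hpu hpa
    have e1 : p ≤ (a ⊔ v) ⊔ b :=
      hpu.trans (sup_le (le_sup_left.trans le_sup_left)
        (h1.trans (sup_le (sup_le (le_sup_left.trans le_sup_left) le_sup_right)
          (le_sup_right.trans le_sup_left))))
    obtain ⟨q, d, hq, hqv, hd, hdb, hle⟩ := hb _ _ p hp e1
      (fun h => hpa (h6 ▸ le_inf hpu h))
      (fun h => hpa (h4 ▸ le_inf (h.trans le_sup_right) hpu))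
    refine ⟨q, hq, hqv, fun hqa => hpa ?_, hle.trans
      (sup_le le_sup_right ((hdb.trans le_sup_left).trans le_sup_left))⟩
    exact h4 ▸ le_inf (hle.trans (sup_le_sup hqa hdb)) hpu
  have hQ : ∀ p : M, IsAtom p → p ≤ a ⊔ v → ¬ p ≤ a →
      ∃ q : M, IsAtom q ∧ q ≤ a ⊔ u ∧ ¬ q ≤ a ∧ p ≤ b ⊔ c ⊔ q := by
    intro p hp hpu hpa
    have e1 : p ≤ (a ⊔ u) ⊔ c :=
      hpu.trans (sup_le (le_sup_left.trans le_sup_left)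
        (h2.trans (sup_le (sup_le (le_sup_left.trans le_sup_left) le_sup_right)
          (le_sup_right.trans le_sup_left))))
    obtain ⟨q, d, hq, hqv, hd, hdb, hle⟩ := hb _ _ p hp e1
      (fun h => hpa (h6 ▸ le_inf h hpu))
      (fun h => hpa (h5 ▸ le_inf (h.trans le_sup_right) hpu))
    refine ⟨q, hq, hqv, fun hqa => hpa ?_, hle.trans
      (sup_le le_sup_right ((hdb.trans le_sup_right).trans le_sup_left))⟩
    exact h5 ▸ le_inf (hle.trans (sup_le_sup hqa hdb)) hpu
  obtain ⟨p₀, hp₀, hp₀u, hp₀a⟩ : ∃ p : M, IsAtom p ∧ p ≤ a ⊔ u ∧ ¬ p ≤ a := by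
    by_contra hcon
    push Not at hcon
    obtain ⟨s, hs, hlub⟩ := hA u
    exact hu (hlub.2 fun p hp => hcon p (hs p hp) ((hlub.1 hp).trans le_sup_right))
  obtain ⟨m, ⟨p, hp, hpu, hpa, rfl⟩, hmax⟩ :=
    hN {m | ∃ p : M, IsAtom p ∧ p ≤ a ⊔ u ∧ ¬ p ≤ a ∧ m = b ⊔ c ⊔ p}
      ⟨_, p₀, hp₀, hp₀u, hp₀a, rfl⟩
  obtain ⟨q, hq, hqv, hqa, hpq⟩ := hP p hp hpu hpa
  obtain ⟨r, hr, hru, hra, hqr⟩ := hQ q hq hqv hqa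
  have l1 : b ⊔ c ⊔ p ≤ b ⊔ c ⊔ q := sup_le le_sup_left hpq
  have l2 : b ⊔ c ⊔ q ≤ b ⊔ c ⊔ r := sup_le le_sup_left hqr
  have e : b ⊔ c ⊔ p = b ⊔ c ⊔ r :=
    (l1.trans l2).eq_of_not_lt (hmax _ ⟨r, hr, hru, hra, rfl⟩)
  have e2 : b ⊔ c ⊔ p = b ⊔ c ⊔ q := le_antisymm l1 (l2.trans e.ge)
  have hne : p ≠ q := by
    rintro rfl
    exact hpa (h6 ▸ le_inf hpu hqv)
  have hbot : p ⊓ q = ⊥ := (hp.disjoint_of_ne hq hne).eq_bot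
  have e3 := hSD _ _ _ e2
  rw [hbot, sup_bot_eq] at e3
  exact hpa ((le_inf hpu (le_sup_right.trans e3.le)).trans h3)
end

section
/- Every finite, atomistic, biatomic, join-semidistributive lattice satisfies the quasi-identity: if u ≤ a ∨ b ∨ v, v ≤ a ∨ c ∨ u, (a ∨ u) ∧ (b ∨ c) ≤ a, and (a ∨ b) ∧ (a ∨ u) = (a ∨ c) ∧ (a ∨ v) = (a ∨ u) ∧ (a ∨ v) = a, then u ≤ a. -/
theorem jsd_aux1 {M : Type} [Lattice M] [OrderBot M] (hSD : JoinSemidistributive M)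
    (x y : M) (T : Finset M) : y ≤ x ⊔ T.sup id → (∀ t ∈ T, t ≤ x ⊔ y) →
    (∀ t ∈ T, t ⊓ y = ⊥) → y ≤ x := by
  classical
  induction T using Finset.induction_on with
  | empty => intro h _ _; simpa using h
  | insert t T' ht ih =>
    intro h1 h2 h3
    rw [Finset.sup_insert, id] at h1
    have hT : T'.sup id ≤ x ⊔ y :=
      Finset.sup_le fun r hr => h2 r (Finset.mem_insert_of_mem hr)
    have e : (x ⊔ T'.sup id) ⊔ t = (x ⊔ T'.sup id) ⊔ y := by
      apply le_antisymm
      · refine sup_le le_sup_left ((h2 t (Finset.mem_insert_self _ _)).trans ?_)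
        exact sup_le_sup_right le_sup_left _
      · refine sup_le le_sup_left (h1.trans (le_of_eq ?_))
        ac_rfl
    have e2 := hSD _ _ _ e
    rw [h3 t (Finset.mem_insert_self _ _), sup_bot_eq] at e2
    refine ih ?_ (fun r hr => h2 r (Finset.mem_insert_of_mem hr))
      (fun r hr => h3 r (Finset.mem_insert_of_mem hr))
    rw [← e2, e]
    exact le_sup_right

theorem jsd_aux2 {M : Type} [Lattice M] [OrderBot M] (hSD : JoinSemidistributive M)
    (x : M) (S T : Finset M) : S.sup id ≤ x ⊔ T.sup id → T.sup id ≤ x ⊔ S.sup id →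
    (∀ s ∈ S, ∀ t ∈ T, t ⊓ s = ⊥) → S.sup id ≤ x := by
  classical
  induction S using Finset.induction_on with
  | empty => intro _ _ _; simp
  | insert s S' hs ih =>
    intro h1 h2 h3
    rw [Finset.sup_insert, id] at h1 h2 ⊢
    have key : s ≤ x ⊔ S'.sup id := by
      refine jsd_aux1 hSD _ s T ?_ ?_ (h3 s (Finset.mem_insert_self _ _))
      · exact (le_sup_left.trans h1).trans (sup_le_sup_right le_sup_left _)
      · intro t ht
        refine ((Finset.le_sup (f := id) ht).trans h2).trans (le_of_eq ?_)
        ac_rfl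
    have hS : S'.sup id ≤ x := by
      refine ih (le_sup_right.trans h1) (h2.trans ?_)
        (fun r hr => h3 r (Finset.mem_insert_of_mem hr))
      exact sup_le le_sup_left (sup_le key le_sup_right)
    exact sup_le (key.trans (sup_le le_rfl hS)) hS

theorem stmt_14 (M : Type) [Lattice M] [Fintype M] [OrderBot M]
    (hA : AtomisticLat M) (hB : IsBiatomicLat M)
    (hSD : JoinSemidistributive M)
    (a b c u v : M)
    (h1 : u ≤ a ⊔ b ⊔ v) (h2 : v ≤ a ⊔ c ⊔ u)
    (h3 : (a ⊔ u) ⊓ (b ⊔ c) ≤ a)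
    (h4 : (a ⊔ b) ⊓ (a ⊔ u) = a)
    (h5 : (a ⊔ c) ⊓ (a ⊔ v) = a)
    (h6 : (a ⊔ u) ⊓ (a ⊔ v) = a) :
    u ≤ a := by
  classical
  by_contra hu
  obtain ⟨_, hB⟩ := hB
  -- atoms of `a ⊔ u` and of `a ⊔ v` that are not below `a`
  let S : Finset M := Finset.univ.filter fun p => IsAtom p ∧ p ≤ a ⊔ u ∧ ¬ p ≤ a
  let T : Finset M := Finset.univ.filter fun p => IsAtom p ∧ p ≤ a ⊔ v ∧ ¬ p ≤ a
  have memS : ∀ p, p ∈ S ↔ IsAtom p ∧ p ≤ a ⊔ u ∧ ¬ p ≤ a := fun p => by simp [S]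
  have memT : ∀ p, p ∈ T ↔ IsAtom p ∧ p ≤ a ⊔ v ∧ ¬ p ≤ a := fun p => by simp [T]
  have hv : ¬ v ≤ a := by
    intro hv
    apply hu
    rw [← h4]
    refine le_inf (h1.trans ?_) le_sup_right
    exact sup_le le_rfl (hv.trans le_sup_left)
  have hb : b ≠ ⊥ := by
    rintro rfl
    apply hu
    rw [← h6]
    exact le_inf le_sup_right (by simpa using h1)
  have hc : c ≠ ⊥ := by
    rintro rfl
    apply hv
    rw [← h6]
    exact le_inf (by simpa using h2) le_sup_right
  have hau : a ⊔ u ≠ ⊥ := fun h => hu ((le_sup_right.trans h.le).trans bot_le)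
  have hav : a ⊔ v ≠ ⊥ := fun h => hv ((le_sup_right.trans h.le).trans bot_le)
  have hS : S.sup id ≤ b ⊔ c := by
    refine jsd_aux2 hSD (b ⊔ c) S T ?_ ?_ ?_
    · refine Finset.sup_le fun p hp => ?_
      obtain ⟨hp1, hp2, hp3⟩ := (memS p).1 hp
      have hle : p ≤ b ⊔ (a ⊔ v) := hp2.trans
        (sup_le (le_sup_left.trans le_sup_right) (h1.trans (le_of_eq (by ac_rfl))))
      obtain ⟨x, y, hx, hxb, hy, hyv, hxy⟩ := hB p b (a ⊔ v) hp1 hb hav hle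
      have hyT : y ∈ T := by
        refine (memT y).2 ⟨hy, hyv, fun hya => hp3 ?_⟩
        rw [← h4]
        exact le_inf (hxy.trans (sup_le (hxb.trans le_sup_right) (hya.trans le_sup_left))) hp2
      exact hxy.trans (sup_le_sup (hxb.trans le_sup_left) (Finset.le_sup (f := id) hyT))
    · refine Finset.sup_le fun p hp => ?_
      obtain ⟨hp1, hp2, hp3⟩ := (memT p).1 hp
      have hle : p ≤ c ⊔ (a ⊔ u) := hp2.trans
        (sup_le (le_sup_left.trans le_sup_right) (h2.trans (le_of_eq (by ac_rfl))))
      obtain ⟨x, y, hx, hxb, hy, hyv, hxy⟩ := hB p c (a ⊔ u) hp1 hc hau hle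
      have hyS : y ∈ S := by
        refine (memS y).2 ⟨hy, hyv, fun hya => hp3 ?_⟩
        rw [← h5]
        exact le_inf (hxy.trans (sup_le (hxb.trans le_sup_right) (hya.trans le_sup_left))) hp2
      exact hxy.trans (sup_le_sup (hxb.trans le_sup_right) (Finset.le_sup (f := id) hyS))
    · intro s hs t ht
      obtain ⟨hs1, hs2, hs3⟩ := (memS s).1 hs
      obtain ⟨ht1, ht2, ht3⟩ := (memT t).1 ht
      refine (ht1.disjoint_of_ne hs1 ?_).eq_bot
      rintro rfl
      apply hs3
      rw [← h6]
      exact le_inf hs2 ht2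
  obtain ⟨s, hs, hlub⟩ := hA u
  apply hu
  refine hlub.2 fun p hp => ?_
  by_contra hpa
  have hpu : p ≤ a ⊔ u := (hlub.1 hp).trans le_sup_right
  have hpS : p ∈ S := (memS p).2 ⟨hs p hp, hpu, hpa⟩
  exact hpa ((le_inf hpu ((Finset.le_sup (f := id) hpS).trans hS)).trans h3)
end
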